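/- Let n > 2 be an integer and let X : D_{2ⁿ} → ℤ be such that the eta quotient η^X is holomorphic. If equality |X_1| + |X_{2ⁿ}| = 2·Σ_{d|2ⁿ} X_d holds, then both X_1 and X_{2ⁿ} are even. -/

import Mathlib

open Finset

/-- `24` times the order of the eta quotient `η^X` at the cusp `1/t` of `Γ₀(N)`:
`∑_{d ∣ N} (N · gcd(d,t)²)/(d · gcd(t²,N)) · X_d`. -/
def etaOrd (N : ℕ) (X : ℕ → ℤ) (t : ℕ) : ℚ :=
  ∑ d ∈ N.divisors,
    ((N : ℚ) * (Nat.gcd d t : ℚ) ^ 2 / ((d : ℚ) * (Nat.gcd (t ^ 2) N : ℚ))) * (X d : ℚ)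

/-- The eta quotient `η^X` on `Γ₀(N)` is holomorphic: all cusp orders are nonnegative. -/
def IsHolEta (N : ℕ) (X : ℕ → ℤ) : Prop :=
  ∀ t ∈ N.divisors, 0 ≤ etaOrd N X t

/-- The exponent vector `X` is supported on the divisors of `N`, i.e. `X : D_N → ℤ`. -/
def SuppIn (N : ℕ) (X : ℕ → ℤ) : Prop :=
  ∀ d : ℕ, ¬ d ∣ N → X d = 0

/-- The kernel `2^{-|i-j|}`, to which the order matrix of level `2ⁿ` is proportional row by row. -/
def halfPowDist (i j : ℕ) : ℚ := (1 / 2) ^ ((i - j) + (j - i))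

theorem halfPowDist_zero_sub (i : ℕ) :
    4 * halfPowDist i 0 - 2 * halfPowDist i 1 = if i = 0 then 3 else 0 := by
  unfold halfPowDist
  rcases i with _ | i
  · norm_num
  · simp [pow_succ]
    ring

theorem halfPowDist_succ_sub (i j : ℕ) :
    5 * halfPowDist i (j + 1) - 2 * halfPowDist i j - 2 * halfPowDist i (j + 2) =
      if i = j + 1 then 3 else 0 := by
  unfold halfPowDist
  rcases lt_trichotomy i (j + 1) with h | rfl | h
  · obtain ⟨k, rfl⟩ := Nat.exists_eq_add_of_le (Nat.le_of_lt_succ h)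
    rw [if_neg (by omega), show i - (i + k + 1) + (i + k + 1 - i) = k + 1 by omega,
      show i - (i + k) + (i + k - i) = k by omega,
      show i - (i + k + 2) + (i + k + 2 - i) = k + 2 by omega]
    ring
  · rw [if_pos rfl, show j + 1 - (j + 1) + (j + 1 - (j + 1)) = 0 by omega,
      show j + 1 - j + (j - (j + 1)) = 1 by omega,
      show j + 1 - (j + 2) + (j + 2 - (j + 1)) = 1 by omega]
    norm_num
  · obtain ⟨k, rfl⟩ := Nat.exists_eq_add_of_le (Nat.succ_le_of_lt h)
    rw [if_neg (by omega),
      show (j + 1).succ + k - (j + 1) + (j + 1 - ((j + 1).succ + k)) = k + 1 by omega,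
      show (j + 1).succ + k - j + (j - ((j + 1).succ + k)) = k + 2 by omega,
      show (j + 1).succ + k - (j + 2) + (j + 2 - ((j + 1).succ + k)) = k by omega]
    ring

theorem halfPowDist_last_sub {i n : ℕ} (hi : i ≤ n + 1) :
    4 * halfPowDist i (n + 1) - 2 * halfPowDist i n = if i = n + 1 then 3 else 0 := by
  unfold halfPowDist
  rcases hi.eq_or_lt with rfl | h
  · rw [if_pos rfl, show n + 1 - (n + 1) + (n + 1 - (n + 1)) = 0 by omega,
      show n + 1 - n + (n - (n + 1)) = 1 by omega]
    norm_num
  · obtain ⟨k, rfl⟩ := Nat.exists_eq_add_of_le (Nat.le_of_lt_succ h)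
    rw [if_neg (by omega), show i - (i + k + 1) + (i + k + 1 - i) = k + 1 by omega,
      show i - (i + k) + (i + k - i) = k by omega]
    ring

theorem gcd_two_pow_sq (i j : ℕ) :
    ((Nat.gcd (2 ^ i) (2 ^ j) : ℕ) : ℚ) ^ 2 = 2 ^ i * 2 ^ j * halfPowDist i j := by
  unfold halfPowDist
  rcases le_total i j with h | h
  · obtain ⟨k, rfl⟩ := Nat.exists_eq_add_of_le h
    rw [Nat.gcd_eq_left (pow_dvd_pow 2 h), show i - (i + k) + (i + k - i) = k by omega]
    push_cast
    rw [pow_add, one_div, inv_pow]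
    field_simp
  · obtain ⟨k, rfl⟩ := Nat.exists_eq_add_of_le h
    rw [Nat.gcd_eq_right (pow_dvd_pow 2 h), show j + k - j + (j - (j + k)) = k by omega]
    push_cast
    rw [pow_add, one_div, inv_pow]
    field_simp

/-- A positive multiple of the order of `η^X` at the cusp `1/2^j`, where `x i = X (2^i)`. -/
def normalizedOrd (n : ℕ) (x : ℕ → ℤ) (j : ℕ) : ℚ :=
  ∑ i ∈ range (n + 1), halfPowDist i j * x i

theorem sum_divisors_two_pow {M : Type*} [AddCommMonoid M] (n : ℕ) (f : ℕ → M) :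
    ∑ d ∈ (2 ^ n).divisors, f d = ∑ i ∈ range (n + 1), f (2 ^ i) :=
  Nat.sum_divisors_prime_pow Nat.prime_two

theorem etaOrd_two_pow (n j : ℕ) (X : ℕ → ℤ) :
    etaOrd (2 ^ n) X (2 ^ j) =
      2 ^ n * 2 ^ j / (Nat.gcd ((2 ^ j) ^ 2) (2 ^ n) : ℚ) *
        normalizedOrd n (fun i => X (2 ^ i)) j := by
  unfold etaOrd normalizedOrd
  rw [sum_divisors_two_pow, mul_sum]
  refine sum_congr rfl fun i _ => ?_
  have hg : ((Nat.gcd ((2 ^ j) ^ 2) (2 ^ n) : ℕ) : ℚ) ≠ 0 := by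
    exact_mod_cast (Nat.gcd_pos_of_pos_right _ (by positivity)).ne'
  rw [gcd_two_pow_sq]
  push_cast
  field_simp

theorem normalizedOrd_nonneg {n : ℕ} {X : ℕ → ℤ} (h : IsHolEta (2 ^ n) X) {j : ℕ}
    (hj : j ≤ n) : 0 ≤ normalizedOrd n (fun i => X (2 ^ i)) j := by
  have hord := h (2 ^ j) (Nat.mem_divisors.2 ⟨pow_dvd_pow 2 hj, by positivity⟩)
  rw [etaOrd_two_pow] at hord
  have hg : (0 : ℚ) < (Nat.gcd ((2 ^ j) ^ 2) (2 ^ n) : ℕ) := by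
    exact_mod_cast Nat.gcd_pos_of_pos_right _ (by positivity)
  exact nonneg_of_mul_nonneg_right hord (by positivity)

theorem three_mul_zero_eq (n : ℕ) (x : ℕ → ℤ) :
    3 * (x 0 : ℚ) = 4 * normalizedOrd n x 0 - 2 * normalizedOrd n x 1 := by
  simp only [normalizedOrd, mul_sum, ← sum_sub_distrib, ← mul_assoc, ← sub_mul,
    halfPowDist_zero_sub]
  simp

theorem three_mul_succ_eq {n j : ℕ} (hj : j + 1 ≤ n) (x : ℕ → ℤ) :
    3 * (x (j + 1) : ℚ) =
      5 * normalizedOrd n x (j + 1) - 2 * normalizedOrd n x j - 2 * normalizedOrd n x (j + 2) := by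
  simp only [normalizedOrd, mul_sum, ← sum_sub_distrib, ← mul_assoc, ← sub_mul,
    halfPowDist_succ_sub]
  simp only [ite_mul, zero_mul, sum_ite_eq', mem_range]
  rw [if_pos (by omega)]

theorem three_mul_last_eq (n : ℕ) (x : ℕ → ℤ) :
    3 * (x (n + 1) : ℚ) =
      4 * normalizedOrd (n + 1) x (n + 1) - 2 * normalizedOrd (n + 1) x n := by
  simp only [normalizedOrd, mul_sum, ← sum_sub_distrib, ← mul_assoc, ← sub_mul]
  rw [sum_congr rfl fun i hi => by
    rw [halfPowDist_last_sub (Nat.le_of_lt_succ (mem_range.1 hi))]]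
  simp

theorem three_mul_partial_sum_eq {n k : ℕ} (hk : k + 1 ≤ n) (x : ℕ → ℤ) :
    3 * ∑ j ∈ range (k + 2), (x j : ℚ) =
      2 * normalizedOrd n x 0 + normalizedOrd n x 1 + ∑ i ∈ range k, normalizedOrd n x (i + 2) +
        2 * normalizedOrd n x (k + 1) - 2 * normalizedOrd n x (k + 2) := by
  induction k with
  | zero =>
    have h₀ := three_mul_zero_eq n x
    have h₁ := three_mul_succ_eq hk x
    simp only [zero_add] at h₁
    simp only [sum_range_succ, range_zero, sum_empty, zero_add]
    linarith
  | succ k ih =>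
    have h := three_mul_succ_eq hk x
    rw [sum_range_succ, mul_add, ih (by omega), sum_range_succ]
    linarith

/-- The sum of the exponents as a positive combination of the normalized orders. -/
theorem three_mul_sum_eq (m : ℕ) (x : ℕ → ℤ) :
    3 * ∑ j ∈ range (m + 4), (x j : ℚ) =
      2 * normalizedOrd (m + 3) x 0 + normalizedOrd (m + 3) x 1 +
        ∑ i ∈ range m, normalizedOrd (m + 3) x (i + 2) +
        normalizedOrd (m + 3) x (m + 2) + 2 * normalizedOrd (m + 3) x (m + 3) := by
  have hp := three_mul_partial_sum_eq (n := m + 3) (k := m + 1) (by omega) x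
  have hl := three_mul_last_eq (m + 2) x
  rw [sum_range_succ _ m] at hp
  rw [sum_range_succ, mul_add]
  linarith

theorem abs_sub_le_and_eq_zero_of_add_le {a b : ℚ} (ha : 0 ≤ a) (hb : 0 ≤ b) :
    |a - b| ≤ a + b ∧ (a + b ≤ |a - b| → a = 0 ∨ b = 0) := by
  refine ⟨abs_le.2 ⟨by linarith, by linarith⟩, fun h => ?_⟩
  rcases abs_cases (a - b) with ⟨h', _⟩ | ⟨h', _⟩
  · right; linarith
  · left; linarith

theorem even_of_boundary_relations {a b c : ℤ} {u₀ u₁ u₂ : ℚ}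
    (ha : 3 * (a : ℚ) = 4 * u₀ - 2 * u₁) (hb : 3 * (b : ℚ) = 5 * u₁ - 2 * u₀ - 2 * u₂)
    (hc : 3 * (c : ℚ) = -2 * u₂) (hu : u₀ = 0 ∨ u₁ = 0) : Even a := by
  rcases hu with rfl | rfl
  · have h : (2 * b : ℚ) = -5 * a + 2 * c := by linarith
    have h' : 2 * b = -5 * a + 2 * c := by exact_mod_cast h
    exact Int.even_iff.2 (by omega)
  · have h : (a : ℚ) = -2 * b + 2 * c := by linarith
    have h' : a = -2 * b + 2 * c := by exact_mod_cast h
    exact Int.even_iff.2 (by omega)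

theorem even_ends_of_normalizedOrd_nonneg (m : ℕ) (x : ℕ → ℤ)
    (hv : ∀ j ≤ m + 3, 0 ≤ normalizedOrd (m + 3) x j)
    (heq : |x 0| + |x (m + 3)| = 2 * ∑ j ∈ range (m + 4), x j) :
    Even (x 0) ∧ Even (x (m + 3)) := by
  have hsum := three_mul_sum_eq m x
  have hfirst := three_mul_zero_eq (m + 3) x
  have hsecond := three_mul_succ_eq (n := m + 3) (j := 0) (by omega) x
  have hpenult := three_mul_succ_eq (n := m + 3) (j := m + 1) (by omega) x
  have hlast := three_mul_last_eq (m + 2) x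
  have heqQ : |(x 0 : ℚ)| + |(x (m + 3) : ℚ)| = 2 * ∑ j ∈ range (m + 4), (x j : ℚ) := by
    exact_mod_cast heq
  simp only [zero_add, add_assoc, Nat.reduceAdd] at hsecond hpenult hlast
  generalize normalizedOrd (m + 3) x = v at *
  have hint : ∀ i ∈ range m, 0 ≤ v (i + 2) := fun i hi =>
    hv _ (by have := mem_range.1 hi; omega)
  have hintsum := sum_nonneg hint
  have ⟨hle₀, hzero₀⟩ := abs_sub_le_and_eq_zero_of_add_le (a := 4 * v 0) (b := 2 * v 1)
    (by linarith [hv 0 (by omega)]) (by linarith [hv 1 (by omega)])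
  have ⟨hle₁, hzero₁⟩ := abs_sub_le_and_eq_zero_of_add_le (a := 4 * v (m + 3))
    (b := 2 * v (m + 2)) (by linarith [hv (m + 3) (by omega)])
    (by linarith [hv (m + 2) (by omega)])
  rw [← hfirst, abs_mul, abs_of_pos (by norm_num : (0 : ℚ) < 3)] at hle₀ hzero₀
  rw [← hlast, abs_mul, abs_of_pos (by norm_num : (0 : ℚ) < 3)] at hle₁ hzero₁
  have hstart : v 0 = 0 ∨ v 1 = 0 := by simpa using hzero₀ (by linarith)
  have hend : v (m + 3) = 0 ∨ v (m + 2) = 0 := by simpa using hzero₁ (by linarith)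
  have hinner := (sum_eq_zero_iff_of_nonneg hint).1 (by linarith)
  obtain ⟨c, hc⟩ : ∃ c : ℤ, 3 * (c : ℚ) = -2 * v 2 := by
    rcases m with _ | m
    · rcases hend with h | h
      · exact ⟨x 3, by simp only [zero_add] at hlast h; linarith⟩
      · exact ⟨0, by simp only [zero_add] at h; simp [h]⟩
    · exact ⟨0, by simp [hinner 0 (by simp)]⟩
  obtain ⟨c', hc'⟩ : ∃ c : ℤ, 3 * (c : ℚ) = -2 * v (m + 1) := by
    rcases m with _ | m
    · rcases hstart with h | h
      · exact ⟨x 0, by simp only [zero_add]; linarith⟩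
      · exact ⟨0, by simp [h]⟩
    · exact ⟨0, by simp [hinner m (by simp)]⟩
  exact ⟨even_of_boundary_relations hfirst hsecond hc hstart,
    even_of_boundary_relations hlast (by linarith : 3 * (x (m + 2) : ℚ) = _) hc' hend⟩

/-- For `n > 2` and `η^X` holomorphic of level dividing `2ⁿ`, if
`|X_1| + |X_{2ⁿ}| = 2·σ(X)`, then both `X_1` and `X_{2ⁿ}` are even. -/
theorem even_of_eq_twice_sigma (n : ℕ) (hn : 2 < n) (X : ℕ → ℤ)
    (hsupp : SuppIn (2 ^ n) X) (hhol : IsHolEta (2 ^ n) X)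
    (heq : |X 1| + |X (2 ^ n)| = 2 * ∑ d ∈ (2 ^ n).divisors, X d) :
    Even (X 1) ∧ Even (X (2 ^ n)) := by
  obtain ⟨m, rfl⟩ := Nat.exists_eq_add_of_le' hn
  rw [sum_divisors_two_pow] at heq
  simpa using even_ends_of_normalizedOrd_nonneg m (fun i => X (2 ^ i))
    (fun j hj => normalizedOrd_nonneg hhol hj) (by simpa using heq)
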